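/- arXiv:2510.26123 — 2 statements merged into one kernel-verified Lean document; each statement's English description precedes it below -/
import Mathlib

section
/- Fix an integer r ≥ 1. Let τ be the smallest n ≥ 1 with R(n) = −r (τ is almost surely finite, since R is a recurrent lazy random walk on ℤ), and let E be the event {L(n) ≥ 0 for all 0 ≤ n ≤ τ}. Then 𝔼[(L(τ) + 1)·𝟙_E] ≤ 1; in particular this expectation is finite. -/
open MeasureTheory
open scoped ENNReal

/-- The three steps of the walk. -/
def walkStep : Fin 3 → ℤ × ℤ := ![(1, -1), (-1, 0), (0, 1)]

lemma walkStep_injective : Function.Injective walkStep := by decide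

lemma walkStep_mem (i : Fin 3) :
    walkStep i ∈ ({(1, -1), (-1, 0), (0, 1)} : Set (ℤ × ℤ)) := by
  fin_cases i <;> simp [walkStep]

/-- The first `n` increments of a path. -/
def increments {Ω : Type*} (Z : ℕ → Ω → ℤ × ℤ) (n : ℕ) (ω : Ω) : Fin n → ℤ × ℤ :=
  fun j => Z ((j : ℕ) + 1) ω - Z (j : ℕ) ω

/-- The position after `k` steps of the path with the given increments. -/
def position {n : ℕ} (ε : Fin n → ℤ × ℤ) (k : ℕ) : ℤ × ℤ :=
  ∑ j ∈ Finset.range k, if h : j < n then ε ⟨j, h⟩ else 0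

lemma position_increments {Ω : Type*} {Z : ℕ → Ω → ℤ × ℤ} (hStart : ∀ ω, Z 0 ω = (0, 0))
    {n k : ℕ} (hk : k ≤ n) (ω : Ω) : position (increments Z n ω) k = Z k ω := by
  have h : position (increments Z n ω) k
      = ∑ j ∈ Finset.range k, (Z (j + 1) ω - Z j ω) := by
    refine Finset.sum_congr rfl fun j hj => ?_
    have : j < n := (Finset.mem_range.1 hj).trans_le hk
    simp [this, increments]
  rw [h, Finset.sum_range_sub (fun j => Z j ω), hStart]
  exact sub_zero _

lemma position_snoc {n k : ℕ} (ε : Fin n → ℤ × ℤ) (s : ℤ × ℤ) (hk : k ≤ n) :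
    position (Fin.snoc (α := fun _ => ℤ × ℤ) ε s) k = position ε k := by
  refine Finset.sum_congr rfl fun j hj => ?_
  have : j < n := (Finset.mem_range.1 hj).trans_le hk
  simp [this, this.trans (Nat.lt_succ_self n), Fin.snoc]

lemma position_snoc_succ {n : ℕ} (ε : Fin n → ℤ × ℤ) (s : ℤ × ℤ) :
    position (Fin.snoc (α := fun _ => ℤ × ℤ) ε s) (n + 1) = position ε n + s := by
  have h := position_snoc ε s le_rfl
  unfold position at h ⊢
  rw [Finset.sum_range_succ, h]
  simp [Fin.snoc]

/-- The probability that the lazy walk on `ℕ` started at `y` avoids `0` up to time `n`. -/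
noncomputable def survival : ℕ → ℕ → ℝ
  | 0, 0 => 0
  | 0, _ + 1 => 1
  | _ + 1, 0 => 0
  | n + 1, y + 1 => (survival n y + survival n (y + 1) + survival n (y + 2)) / 3

lemma survival_zero_right (n : ℕ) : survival n 0 = 0 := by
  cases n <;> rw [survival]

lemma survival_nonneg (n y : ℕ) : 0 ≤ survival n y := by
  induction n generalizing y with
  | zero => cases y <;> norm_num [survival]
  | succ n ih =>
    cases y with
    | zero => rw [survival]
    | succ y =>
      rw [survival]
      linarith [ih y, ih (y + 1), ih (y + 2)]

lemma survival_le_one (n y : ℕ) : survival n y ≤ 1 := by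
  induction n generalizing y with
  | zero => cases y <;> norm_num [survival]
  | succ n ih =>
    cases y with
    | zero => norm_num [survival]
    | succ y =>
      rw [survival]
      linarith [ih y, ih (y + 1), ih (y + 2)]

lemma survival_succ_le (n y : ℕ) : survival (n + 1) y ≤ survival n y := by
  induction n generalizing y with
  | zero =>
    cases y with
    | zero => simp [survival_zero_right]
    | succ y => rw [survival.eq_2]; exact survival_le_one _ _
  | succ n ih =>
    cases y with
    | zero => simp [survival_zero_right]
    | succ y =>
      linarith [survival.eq_4 (n + 1) y, survival.eq_4 n y, ih y, ih (y + 1), ih (y + 2)]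

lemma tendsto_survival (y : ℕ) :
    Filter.Tendsto (fun n => survival n y) Filter.atTop (nhds 0) := by
  have hconv : ∀ y, ∃ a, Filter.Tendsto (fun n => survival n y) Filter.atTop (nhds a) := by
    intro y
    refine ⟨_, tendsto_atTop_ciInf (antitone_nat_of_succ_le fun n => survival_succ_le n y) ?_⟩
    exact ⟨0, by rintro _ ⟨n, rfl⟩; exact survival_nonneg n y⟩
  choose a ha using hconv
  have ha0 : a 0 = 0 :=
    tendsto_nhds_unique (ha 0) (by simp [survival_zero_right])
  have hrec : ∀ y, a (y + 1) = (a y + a (y + 1) + a (y + 2)) / 3 := by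
    intro y
    refine tendsto_nhds_unique ((Filter.tendsto_add_atTop_iff_nat 1).2 (ha (y + 1))) ?_
    simp only [survival]
    exact (((ha y).add (ha (y + 1))).add (ha (y + 2))).div_const 3
  have hlin : ∀ y : ℕ, a y = y * a 1 ∧ a (y + 1) = (y + 1) * a 1 := by
    intro y
    induction y with
    | zero => simp [ha0]
    | succ y ih =>
      refine ⟨by push_cast; exact ih.2, ?_⟩
      have := hrec y
      push_cast
      rw [show y + 1 + 1 = y + 2 from rfl]
      linarith [ih.1, ih.2]
  have hle : ∀ y, a y ≤ 1 := fun y =>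
    le_of_tendsto' (ha y) fun n => survival_le_one n y
  have hge : 0 ≤ a 1 := ge_of_tendsto' (ha 1) fun n => survival_nonneg n 1
  have h1 : a 1 = 0 := by
    by_contra hne
    have hpos : 0 < a 1 := lt_of_le_of_ne hge (Ne.symm hne)
    obtain ⟨k, hk⟩ := exists_nat_gt (1 / a 1)
    rw [div_lt_iff₀ hpos] at hk
    linarith [hle k, (hlin k).1]
  have := ha y
  rwa [(hlin y).1, h1, mul_zero] at this

lemma survival_succ_natAbs {x : ℤ} (hx : x ≠ 0) (n : ℕ) :
    survival (n + 1) x.natAbs =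
      (survival n (x - 1).natAbs + survival n x.natAbs + survival n (x + 1).natAbs) / 3 := by
  obtain ⟨y, hy⟩ : ∃ y, x.natAbs = y + 1 :=
    Nat.exists_eq_succ_of_ne_zero (Int.natAbs_ne_zero.2 hx)
  rcases lt_or_gt_of_ne hx with h | h
  · rw [hy, show (x - 1).natAbs = y + 2 by omega, show (x + 1).natAbs = y by omega, survival]
    ring
  · rw [hy, show (x - 1).natAbs = y by omega, show (x + 1).natAbs = y + 2 by omega, survival]

section Walk

variable {Ω : Type*} [MeasurableSpace Ω] {P : Measure Ω} [IsProbabilityMeasure P]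
  {Z : ℕ → Ω → ℤ × ℤ}

lemma measurable_increments (hMeas : ∀ n, Measurable (Z n)) (n : ℕ) :
    Measurable (increments Z n) :=
  measurable_pi_lambda _ fun j => (hMeas (j + 1)).sub (hMeas j)

lemma lintegral_increments (hMeas : ∀ n, Measurable (Z n))
    (hIID : ∀ (n : ℕ) (ε : Fin n → ℤ × ℤ),
      (∀ j, ε j ∈ ({(1, -1), (-1, 0), (0, 1)} : Set (ℤ × ℤ))) →
      (P {ω | ∀ j : Fin n, Z ((j : ℕ) + 1) ω - Z (j : ℕ) ω = ε j}).toReal = (1 / 3 : ℝ) ^ n)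
    (n : ℕ) (F : (Fin n → ℤ × ℤ) → ℝ≥0∞) :
    ∫⁻ ω, F (increments Z n ω) ∂P = ∑ e : Fin n → Fin 3, F (walkStep ∘ e) * (3⁻¹) ^ n := by
  have hX := measurable_increments hMeas n
  have hprob : IsProbabilityMeasure (P.map (increments Z n)) :=
    Measure.isProbabilityMeasure_map hX.aemeasurable
  have hsing : ∀ e : Fin n → Fin 3,
      P.map (increments Z n) {walkStep ∘ e} = (3⁻¹ : ℝ≥0∞) ^ n := by
    intro e
    rw [Measure.map_apply hX (measurableSet_singleton _)]
    have h := hIID n (walkStep ∘ e) fun j => walkStep_mem _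
    have hset : increments Z n ⁻¹' {walkStep ∘ e} =
        {ω | ∀ j : Fin n, Z ((j : ℕ) + 1) ω - Z (j : ℕ) ω = (walkStep ∘ e) j} := by
      ext ω
      simp [increments, funext_iff]
    rw [hset, ← ENNReal.toReal_eq_toReal_iff' (measure_ne_top _ _)
      (ENNReal.pow_ne_top (by simp)), h]
    simp
  have hinj : Function.Injective fun e : Fin n → Fin 3 => walkStep ∘ e :=
    walkStep_injective.comp_left
  let S : Finset (Fin n → ℤ × ℤ) := Finset.univ.map ⟨_, hinj⟩
  have hS : P.map (increments Z n) S = 1 := by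
    rw [← sum_measure_singleton, Finset.sum_map]
    simp only [Function.Embedding.coeFn_mk, hsing]
    simp only [Finset.sum_const, Finset.card_univ, Fintype.card_fun, Fintype.card_fin,
      nsmul_eq_mul]
    push_cast
    rw [← mul_pow, ENNReal.mul_inv_cancel (by simp) (by simp), one_pow]
  have hSc : P.map (increments Z n) (S : Set (Fin n → ℤ × ℤ))ᶜ = 0 :=
    (prob_compl_eq_zero_iff S.measurableSet).2 hS
  rw [← lintegral_map (measurable_of_countable F) hX,
    ← lintegral_add_compl F S.measurableSet, setLIntegral_measure_zero _ _ hSc, add_zero,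
    lintegral_finset, Finset.sum_map]
  simp only [Function.Embedding.coeFn_mk, hsing]

/-- The Markov property at time `n`, on the event that the walk has stayed in `D`. -/
lemma setLIntegral_succ (hMeas : ∀ n, Measurable (Z n)) (hStart : ∀ ω, Z 0 ω = (0, 0))
    (hIID : ∀ (n : ℕ) (ε : Fin n → ℤ × ℤ),
      (∀ j, ε j ∈ ({(1, -1), (-1, 0), (0, 1)} : Set (ℤ × ℤ))) →
      (P {ω | ∀ j : Fin n, Z ((j : ℕ) + 1) ω - Z (j : ℕ) ω = ε j}).toReal = (1 / 3 : ℝ) ^ n)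
    (D : Set (ℤ × ℤ)) (φ : ℤ × ℤ → ℝ≥0∞) (n : ℕ) :
    ∫⁻ ω in {ω | ∀ k ≤ n, Z k ω ∈ D}, φ (Z (n + 1) ω) ∂P =
      ∫⁻ ω in {ω | ∀ k ≤ n, Z k ω ∈ D},
        (φ (Z n ω + (1, -1)) + φ (Z n ω + (-1, 0)) + φ (Z n ω + (0, 1))) * 3⁻¹ ∂P := by
  classical
  have hB : MeasurableSet {ω | ∀ k ≤ n, Z k ω ∈ D} := by
    simp only [Set.ofPred_forall]
    exact MeasurableSet.iInter fun k => MeasurableSet.iInter fun _ =>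
      hMeas k (Set.to_countable D).measurableSet
  rw [← lintegral_indicator hB, ← lintegral_indicator hB]
  have h1 := lintegral_increments hMeas hIID (n + 1)
    fun ε => if ∀ k ≤ n, position ε k ∈ D then φ (position ε (n + 1)) else 0
  have h2 := lintegral_increments hMeas hIID n
    fun ε => if ∀ k ≤ n, position ε k ∈ D then
      (φ (position ε n + (1, -1)) + φ (position ε n + (-1, 0)) + φ (position ε n + (0, 1))) * 3⁻¹
      else 0
  convert h1.trans (Eq.trans ?_ h2.symm) using 1
  · refine lintegral_congr fun ω => ?_
    rw [Set.indicator_apply, position_increments hStart le_rfl]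
    refine if_congr (forall₂_congr fun k hk => ?_) rfl rfl
    rw [position_increments hStart (hk.trans n.le_succ)]
  · refine lintegral_congr fun ω => ?_
    rw [Set.indicator_apply, position_increments hStart le_rfl]
    refine if_congr (forall₂_congr fun k hk => ?_) rfl rfl
    rw [position_increments hStart hk]
  · rw [← (Fin.snocEquiv fun _ : Fin (n + 1) => Fin 3).sum_comp, Fintype.sum_prod_type,
      Finset.sum_comm]
    refine Finset.sum_congr rfl fun e _ => ?_
    have hsnoc : ∀ i : Fin 3, walkStep ∘ (Fin.snocEquiv (fun _ : Fin (n + 1) => Fin 3)) (i, e)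
        = Fin.snoc (α := fun _ => ℤ × ℤ) (walkStep ∘ e) (walkStep i) := by
      intro i
      exact Fin.comp_snoc walkStep e i
    have hiff : ∀ s, (∀ k ≤ n, position (Fin.snoc (α := fun _ => ℤ × ℤ) (walkStep ∘ e) s) k ∈ D)
        ↔ ∀ k ≤ n, position (walkStep ∘ e) k ∈ D := fun s =>
      forall₂_congr fun k hk => by rw [position_snoc _ _ hk]
    simp only [hsnoc, hiff, position_snoc_succ]
    split_ifs
    · simp only [Fin.sum_univ_three, walkStep, pow_succ]
      simp
      ring
    · simp

/-- Almost surely the second coordinate of the walk visits `-r`. -/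
lemma measure_forall_snd_ne (hMeas : ∀ n, Measurable (Z n)) (hStart : ∀ ω, Z 0 ω = (0, 0))
    (hIID : ∀ (n : ℕ) (ε : Fin n → ℤ × ℤ),
      (∀ j, ε j ∈ ({(1, -1), (-1, 0), (0, 1)} : Set (ℤ × ℤ))) →
      (P {ω | ∀ j : Fin n, Z ((j : ℕ) + 1) ω - Z (j : ℕ) ω = ε j}).toReal = (1 / 3 : ℝ) ^ n)
    (r : ℤ) :
    P {ω | ∀ k, (Z k ω).2 ≠ -r} = 0 := by
  let D : Set (ℤ × ℤ) := {z | z.2 ≠ -r}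
  let φ : ℕ → ℤ × ℤ → ℝ≥0∞ := fun m z => ENNReal.ofReal (survival m (z.2 + r).natAbs)
  have hmeas : ∀ n, MeasurableSet {ω | ∀ k ≤ n, Z k ω ∈ D} := fun n => by
    simp only [Set.ofPred_forall]
    exact MeasurableSet.iInter fun k => MeasurableSet.iInter fun _ =>
      hMeas k (Set.to_countable D).measurableSet
  have hstep : ∀ n m, ∫⁻ ω in {ω | ∀ k ≤ n + 1, Z k ω ∈ D}, φ m (Z (n + 1) ω) ∂P ≤
      ∫⁻ ω in {ω | ∀ k ≤ n, Z k ω ∈ D}, φ (m + 1) (Z n ω) ∂P := by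
    intro n m
    have hsub : {ω | ∀ k ≤ n + 1, Z k ω ∈ D} ⊆ {ω | ∀ k ≤ n, Z k ω ∈ D} :=
      fun ω h k hk => h k (hk.trans n.le_succ)
    refine (lintegral_mono_set hsub).trans ?_
    rw [setLIntegral_succ hMeas hStart hIID]
    refine (setLIntegral_congr_fun (hmeas n) fun ω hω => ?_).le
    have hne : (Z n ω).2 + r ≠ 0 := fun h => hω n le_rfl (by omega)
    simp only [φ]
    rw [survival_succ_natAbs hne, ENNReal.ofReal_div_of_pos (by norm_num),
      ENNReal.ofReal_add (add_nonneg (survival_nonneg _ _) (survival_nonneg _ _))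
        (survival_nonneg _ _),
      ENNReal.ofReal_add (survival_nonneg _ _) (survival_nonneg _ _), div_eq_mul_inv]
    simp only [Prod.snd_add, add_zero]
    rw [show (Z n ω).2 + -1 + r = (Z n ω).2 + r - 1 by ring,
      show (Z n ω).2 + 1 + r = (Z n ω).2 + r + 1 by ring]
    norm_num
  have hle : ∀ n m, ∫⁻ ω in {ω | ∀ k ≤ n, Z k ω ∈ D}, φ m (Z n ω) ∂P ≤
      ENNReal.ofReal (survival (n + m) r.natAbs) := by
    intro n
    induction n with
    | zero =>
      intro m
      refine (setLIntegral_le_lintegral _ _).trans ?_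
      simp [φ, hStart]
    | succ n ih =>
      intro m
      refine (hstep n m).trans ((ih (m + 1)).trans_eq ?_)
      rw [show n + (m + 1) = n + 1 + m by ring]
  have hbound : ∀ n, P {ω | ∀ k, (Z k ω).2 ≠ -r} ≤ ENNReal.ofReal (survival n r.natAbs) := by
    intro n
    refine le_trans ?_ (hle n 0)
    calc P {ω | ∀ k, (Z k ω).2 ≠ -r} ≤ P {ω | ∀ k ≤ n, Z k ω ∈ D} :=
          measure_mono fun ω h k _ => h k
      _ = ∫⁻ ω in {ω | ∀ k ≤ n, Z k ω ∈ D}, 1 ∂P := by simp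
      _ = _ := by
          refine setLIntegral_congr_fun (hmeas n) fun ω hω => ?_
          have hne : (Z n ω).2 + r ≠ 0 := fun h => hω n le_rfl (by omega)
          obtain ⟨y, hy⟩ : ∃ y, ((Z n ω).2 + r).natAbs = y + 1 :=
            Nat.exists_eq_succ_of_ne_zero (Int.natAbs_ne_zero.2 hne)
          simp [φ, hy, survival]
  have hlim := ENNReal.tendsto_ofReal (tendsto_survival r.natAbs)
  rw [ENNReal.ofReal_zero] at hlim
  exact le_antisymm (ge_of_tendsto' hlim hbound) bot_le

/-- The total mass, weighted by `L + 1`, with which the walk leaves the region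
`{L ≥ 0, R ≠ -r}` through `{L ≥ 0, R = -r}`. -/
lemma tsum_setLIntegral_exit_le_one (hMeas : ∀ n, Measurable (Z n))
    (hStart : ∀ ω, Z 0 ω = (0, 0))
    (hIID : ∀ (n : ℕ) (ε : Fin n → ℤ × ℤ),
      (∀ j, ε j ∈ ({(1, -1), (-1, 0), (0, 1)} : Set (ℤ × ℤ))) →
      (P {ω | ∀ j : Fin n, Z ((j : ℕ) + 1) ω - Z (j : ℕ) ω = ε j}).toReal = (1 / 3 : ℝ) ^ n)
    (r : ℤ) :
    ∑' n, ∫⁻ ω in {ω | (∀ k ≤ n, 0 ≤ (Z k ω).1 ∧ (Z k ω).2 ≠ -r) ∧ (Z (n + 1) ω).2 = -r},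
      (((Z (n + 1) ω).1 + 1).toNat : ℝ≥0∞) ∂P ≤ 1 := by
  let D : Set (ℤ × ℤ) := {z | 0 ≤ z.1 ∧ z.2 ≠ -r}
  let h : ℤ × ℤ → ℝ≥0∞ := fun z => ((z.1 + 1).toNat : ℝ≥0∞)
  let B : ℕ → Set Ω := fun n => {ω | ∀ k ≤ n, Z k ω ∈ D}
  let G : ℕ → Set Ω := fun n => {ω | (∀ k ≤ n, Z k ω ∈ D) ∧ (Z (n + 1) ω).2 = -r}
  have hB : ∀ n, MeasurableSet (B n) := fun n => by
    simp only [B, Set.ofPred_forall]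
    exact MeasurableSet.iInter fun k => MeasurableSet.iInter fun _ =>
      hMeas k (Set.to_countable D).measurableSet
  have hstep : ∀ n, ∫⁻ ω in G n, h (Z (n + 1) ω) ∂P + ∫⁻ ω in B (n + 1), h (Z (n + 1) ω) ∂P ≤
      ∫⁻ ω in B n, h (Z n ω) ∂P := by
    intro n
    rw [← lintegral_union (hB (n + 1)) (Set.disjoint_left.2 fun ω hG hb =>
      (hb (n + 1) le_rfl).2 hG.2)]
    refine (lintegral_mono_set (t := B n) ?_).trans ?_
    · rintro ω (hω | hω)
      · exact hω.1
      · exact fun k hk => hω k (hk.trans n.le_succ)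
    · rw [setLIntegral_succ hMeas hStart hIID]
      refine (setLIntegral_congr_fun (hB n) fun ω hω => ?_).le
      obtain ⟨l, hl⟩ := Int.eq_ofNat_of_zero_le (hω n le_rfl).1
      simp only [h, Prod.fst_add, hl]
      rw [show ((l : ℤ) + 1 + 1).toNat = l + 2 by omega,
        show ((l : ℤ) + -1 + 1).toNat = l by omega,
        show ((l : ℤ) + 0 + 1).toNat = l + 1 by omega,
        show ((l : ℤ) + 1).toNat = l + 1 by omega]
      have hsum : ((l + 2 : ℕ) : ℝ≥0∞) + (l : ℕ) + (l + 1 : ℕ) = (l + 1 : ℕ) * 3 := by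
        push_cast
        ring
      rw [hsum, mul_assoc, ENNReal.mul_inv_cancel (by norm_num) (by norm_num), mul_one]
  have hsum : ∀ n, ∑ i ∈ Finset.range n, ∫⁻ ω in G i, h (Z (i + 1) ω) ∂P +
      ∫⁻ ω in B n, h (Z n ω) ∂P ≤ 1 := by
    intro n
    induction n with
    | zero =>
      rw [Finset.sum_range_zero, zero_add]
      refine (setLIntegral_le_lintegral _ _).trans ?_
      simp [h, hStart]
    | succ n ih =>
      rw [Finset.sum_range_succ, add_assoc]
      exact (add_le_add_right (hstep n) _).trans ih
  exact ENNReal.tsum_le_of_sum_range_le fun n => le_self_add.trans (hsum n)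

end Walk

/-- Let `Z = (L, R)` be the random walk started from `(0,0)` with i.i.d. increments
uniform on `{(1,-1), (-1,0), (0,1)}`.  Fix `r ≥ 1`, let `τ` be the first time `n ≥ 1`
with `R n = -r`, and let `E` be the event that `L` stays non-negative up to time `τ`.
Then `𝔼[(L τ + 1) · 1_E] ≤ 1`; in particular this expectation is finite. -/
theorem stmt_1
    {Ω : Type*} [MeasurableSpace Ω] (P : Measure Ω) [IsProbabilityMeasure P]
    (Z : ℕ → Ω → ℤ × ℤ)
    (hMeas : ∀ n, Measurable (Z n))
    (hStart : ∀ ω, Z 0 ω = (0, 0))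
    (hIID : ∀ (n : ℕ) (ε : Fin n → ℤ × ℤ),
      (∀ j, ε j ∈ ({(1, -1), (-1, 0), (0, 1)} : Set (ℤ × ℤ))) →
      (P {ω | ∀ j : Fin n, Z ((j : ℕ) + 1) ω - Z (j : ℕ) ω = ε j}).toReal = (1 / 3 : ℝ) ^ n)
    (r : ℤ) (hr : 1 ≤ r)
    (τ : Ω → ℕ)
    (hτ : ∀ ω, τ ω = sInf {n : ℕ | 1 ≤ n ∧ (Z n ω).2 = -r}) :
    (∫⁻ ω in {ω | ∀ n ≤ τ ω, 0 ≤ (Z n ω).1}, (((Z (τ ω) ω).1 + 1).toNat : ℝ≥0∞) ∂P) ≤ 1 := by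
  let G : ℕ → Set Ω := fun n =>
    {ω | (∀ k ≤ n, 0 ≤ (Z k ω).1 ∧ (Z k ω).2 ≠ -r) ∧ (Z (n + 1) ω).2 = -r}
  let f : ℕ → Ω → ℝ≥0∞ := fun n ω => (((Z (n + 1) ω).1 + 1).toNat : ℝ≥0∞)
  have hG : ∀ n, MeasurableSet (G n) := fun n => by
    simp only [G, Set.ofPred_and, Set.ofPred_forall]
    refine MeasurableSet.inter (MeasurableSet.iInter fun k => MeasurableSet.iInter fun _ => ?_) ?_
    · exact hMeas k (Set.to_countable {z : ℤ × ℤ | 0 ≤ z.1 ∧ z.2 ≠ -r}).measurableSet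
    · exact hMeas (n + 1) (Set.to_countable {z : ℤ × ℤ | z.2 = -r}).measurableSet
  have hf : ∀ n, Measurable (f n) := fun n =>
    (measurable_of_countable fun z : ℤ × ℤ => ((z.1 + 1).toNat : ℝ≥0∞)).comp (hMeas (n + 1))
  have hfG : ∀ n, Measurable ((G n).indicator (f n)) := fun n => (hf n).indicator (hG n)
  have hae : ∀ᵐ ω ∂P, ∃ k, (Z k ω).2 = -r := by
    rw [ae_iff]
    simpa using measure_forall_snd_ne hMeas hStart hIID r
  calc _ ≤ ∫⁻ ω in {ω | ∀ n ≤ τ ω, 0 ≤ (Z n ω).1}, ∑' n, (G n).indicator (f n) ω ∂P := by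
        refine setLIntegral_mono_ae (Measurable.tsum hfG).aemeasurable ?_
        filter_upwards [hae] with ω ⟨k, hk⟩ hE
        have hk1 : 1 ≤ k := by
          rcases Nat.eq_zero_or_pos k with rfl | h
          · rw [hStart] at hk
            simp at hk
            omega
          · exact h
        have hmem : τ ω ∈ {n : ℕ | 1 ≤ n ∧ (Z n ω).2 = -r} := by
          rw [hτ]
          exact Nat.sInf_mem ⟨k, hk1, hk⟩
        obtain ⟨n, hn⟩ : ∃ n, τ ω = n + 1 := Nat.exists_eq_succ_of_ne_zero (by
          have := hmem.1; omega)
        have hωG : ω ∈ G n := by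
          refine ⟨fun j hj => ⟨hE j (by omega), fun hjr => ?_⟩, hn ▸ hmem.2⟩
          rcases Nat.eq_zero_or_pos j with rfl | h
          · rw [hStart] at hjr
            simp at hjr
            omega
          · have : τ ω ≤ j := by
              rw [hτ]
              exact Nat.sInf_le ⟨h, hjr⟩
            omega
        refine le_trans ?_ (ENNReal.le_tsum n)
        rw [Set.indicator_of_mem hωG, hn]
    _ ≤ ∫⁻ ω, ∑' n, (G n).indicator (f n) ω ∂P := setLIntegral_le_lintegral _ _
    _ = ∑' n, ∫⁻ ω in G n, f n ω ∂P := by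
        rw [lintegral_tsum fun n => (hfG n).aemeasurable]
        exact tsum_congr fun n => lintegral_indicator (hG n) _
    _ ≤ 1 := tsum_setLIntegral_exit_le_one hMeas hStart hIID r
end

section
/- Suppose (f, g) satisfies the LDP recursive equation, and set κ = 3 + f(0) > 0. Then, as t ↓ 0: F(t) = 1 − (κ/2)^{1/3}·t^{2/3} + o(t^{2/3}); F⁻(t) = (1 − f(0))/2 + ((−1 − i√3)/2)·(κ/2)^{1/3}·t^{2/3} + o(t^{2/3}); and G(t) = 1 + ((−1 − i√3)/2)·(κ/2)^{1/3}·t^{2/3} + o(t^{2/3}). -/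
open Complex Asymptotics Filter Topology

/-- The characteristic function of a function on the integers. -/
noncomputable def charSum (u : ℤ → ℝ) (t : ℝ) : ℂ :=
  ∑' x : ℤ, (u x : ℂ) * Complex.exp (Complex.I * (t : ℂ) * (x : ℂ))

/-- The restriction of a function on the integers to the negative integers. -/
noncomputable def restrictNeg (u : ℤ → ℝ) (x : ℤ) : ℝ := if x < 0 then u x else 0

lemma norm_exp_I_mul_int (t : ℝ) (x : ℤ) :
    ‖Complex.exp (Complex.I * (t : ℂ) * (x : ℂ))‖ = 1 := by
  have h : Complex.I * (t : ℂ) * (x : ℂ) = ((t * x : ℝ) : ℂ) * Complex.I := by push_cast; ring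
  rw [h, Complex.norm_exp_ofReal_mul_I]

lemma norm_charSum_term (u : ℤ → ℝ) (t : ℝ) (x : ℤ) :
    ‖(u x : ℂ) * Complex.exp (Complex.I * (t : ℂ) * (x : ℂ))‖ = |u x| := by
  rw [norm_mul, norm_exp_I_mul_int, mul_one, Complex.norm_real, Real.norm_eq_abs]

lemma summable_norm_charSum_term {u : ℤ → ℝ} (hu : Summable u) (t : ℝ) :
    Summable fun x : ℤ => ‖(u x : ℂ) * Complex.exp (Complex.I * (t : ℂ) * (x : ℂ))‖ := by
  simpa only [norm_charSum_term] using hu.abs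

lemma hasSum_charSum {u : ℤ → ℝ} (hu : Summable u) (t : ℝ) :
    HasSum (fun x : ℤ => (u x : ℂ) * Complex.exp (Complex.I * (t : ℂ) * (x : ℂ)))
      (charSum u t) :=
  (summable_norm_charSum_term hu t).of_norm.hasSum

lemma continuous_charSum {u : ℤ → ℝ} (hu : Summable u) : Continuous (charSum u) :=
  continuous_tsum (fun x => by fun_prop) hu.abs
    (fun x t => (norm_charSum_term u t x).le)

lemma charSum_zero {u : ℤ → ℝ} {s : ℝ} (hu : HasSum u s) : charSum u 0 = s := by
  have h := hasSum_charSum hu.summable 0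
  simp only [Complex.ofReal_zero, mul_zero, zero_mul, Complex.exp_zero, mul_one] at h
  exact h.unique (by exact_mod_cast hu)

lemma summable_restrictNeg {u : ℤ → ℝ} (hu : Summable u) : Summable (restrictNeg u) := by
  refine (hu.indicator {x : ℤ | x < 0}).congr fun x => ?_
  simp [restrictNeg, Set.indicator_apply]

lemma star_charSum (u : ℤ → ℝ) (t : ℝ) :
    (starRingEnd ℂ) (charSum u t) = charSum (fun x => u (-x)) t := by
  unfold charSum
  rw [Complex.conj_tsum, ← (Equiv.neg ℤ).tsum_eq]
  refine tsum_congr fun x => ?_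
  simp only [Equiv.neg_apply, map_mul, Complex.conj_ofReal, ← Complex.exp_conj, Complex.conj_I,
    Int.cast_neg, map_neg, map_intCast]
  congr 2
  ring

/-- The characteristic function of a convolution is the product of the characteristic functions. -/
lemma hasSum_charSum_convolution {u v w : ℤ → ℝ} (hu : Summable u) (hv : Summable v)
    (hw : ∀ y, HasSum (fun j => u (y + j) * v (-j)) (w y)) (t : ℝ) :
    HasSum (fun x : ℤ => (w x : ℂ) * Complex.exp (Complex.I * (t : ℂ) * (x : ℂ)))
      (charSum u t * charSum v t) := by
  have hs := summable_mul_of_summable_norm (summable_norm_charSum_term hu t)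
    (summable_norm_charSum_term hv t)
  have h := HasSum.mul (hasSum_charSum hu t) (hasSum_charSum hv t) hs
  let e : ℤ × ℤ ≃ ℤ × ℤ :=
    { toFun := fun p => (p.1 + p.2, -p.2)
      invFun := fun p => (p.1 + p.2, -p.2)
      left_inv := fun p => by simp
      right_inv := fun p => by simp }
  have h' := e.hasSum_iff.mpr h
  refine h'.prod_fiberwise fun y => ?_
  have h1 : HasSum (fun j => ((u (y + j) * v (-j) : ℝ) : ℂ)) (w y) := by exact_mod_cast hw y
  refine (h1.mul_right (Complex.exp (Complex.I * (t : ℂ) * (y : ℂ)))).congr_fun fun j => ?_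
  have hexp : Complex.exp (Complex.I * (t : ℂ) * (y : ℂ)) =
      Complex.exp (Complex.I * (t : ℂ) * ((y + j : ℤ) : ℂ)) *
        Complex.exp (Complex.I * (t : ℂ) * ((-j : ℤ) : ℂ)) := by
    rw [← Complex.exp_add]
    congr 1
    push_cast
    ring
  simp only [Function.comp_apply, e, Equiv.coe_fn_mk]
  rw [hexp, Complex.ofReal_mul]
  ring

lemma charSum_eq_tsum_nat {u : ℤ → ℝ} (hu : ∀ x : ℤ, 0 ≤ x → u x = 0) (t : ℝ) :
    charSum u t = ∑' k : ℕ, (u (-(k : ℤ) - 1) : ℂ) *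
      Complex.exp (Complex.I * (t : ℂ) * (-(k : ℂ) - 1)) := by
  have hinj : Function.Injective fun k : ℕ => -(k : ℤ) - 1 := fun a b h => by
    simp only at h
    omega
  unfold charSum
  rw [← hinj.tsum_eq]
  · refine tsum_congr fun k => ?_
    push_cast
    rfl
  · intro x hx
    by_contra hx'
    refine hx ?_
    have : 0 ≤ x := by
      by_contra hneg
      exact hx' ⟨(-x - 1).toNat, by simp only; omega⟩
    simp [hu x this]

lemma charSum_of_symm {f : ℤ → ℝ} (hf : Summable f) (hsymm : ∀ x, f (-x) = f x) (t : ℝ) :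
    charSum f t = f 0 + charSum (restrictNeg f) t + (starRingEnd ℂ) (charSum (restrictNeg f) t) := by
  rw [star_charSum]
  have hn := summable_restrictNeg hf
  have h0 := hasSum_ite_eq (0 : ℤ) (f 0 : ℂ)
  refine (hasSum_charSum hf t).unique
    (((h0.add (hasSum_charSum hn t)).add
      (hasSum_charSum ((Equiv.neg ℤ).summable_iff.mpr hn) t)).congr_fun fun x => ?_)
  simp only [restrictNeg, Function.comp_apply, Equiv.neg_apply, hsymm]
  rcases lt_trichotomy x 0 with hx | rfl | hx
  · simp [hx, hx.ne, hx.le]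
  · simp
  · simp [hx, hx.ne', hx.le]

/-- The equation satisfied by the characteristic function of `g`. -/
lemma charSum_quadratic {f g : ℤ → ℝ} {c : ℝ} (hf : Summable f) (hg : Summable g)
    (hgsupp : ∀ y : ℤ, 0 ≤ y → g y = 0)
    (h : ∀ y : ℤ, y ≤ -1 → 3 * g y = f y + (∑ j ∈ Finset.Icc (1 : ℤ) (-y - 1), g (y + j) * g (-j)) +
      if y = -1 then c else 0) (t : ℝ) :
    3 * charSum g t = charSum (restrictNeg f) t + charSum g t ^ 2 +
      c * Complex.exp (-(Complex.I * t)) := by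
  have hconv : ∀ y : ℤ, HasSum (fun j => g (y + j) * g (-j))
      (∑ j ∈ Finset.Icc (1 : ℤ) (-y - 1), g (y + j) * g (-j)) := fun y =>
    hasSum_sum_of_ne_finset_zero fun j hj => by
      rw [Finset.mem_Icc, not_and_or] at hj
      rcases hj with hj | hj
      · rw [hgsupp (-j) (by omega), mul_zero]
      · rw [hgsupp (y + j) (by omega), zero_mul]
  have h1 := hasSum_charSum_convolution hg hg hconv t
  have h2 := hasSum_ite_eq (-1 : ℤ) ((c : ℂ) * Complex.exp (-(Complex.I * t)))
  rw [sq]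
  refine ((hasSum_charSum hg t).mul_left 3).unique
    ((((hasSum_charSum (summable_restrictNeg hf) t).add h1).add h2).congr_fun fun y => ?_)
  by_cases hy : y ≤ -1
  · have h3 : (3 : ℂ) * g y = f y + ((∑ j ∈ Finset.Icc (1 : ℤ) (-y - 1), g (y + j) * g (-j) : ℝ) : ℂ)
        + if y = -1 then (c : ℂ) else 0 := by
      have := congrArg (fun r : ℝ => (r : ℂ)) (h y hy)
      simp only [apply_ite (fun r : ℝ => (r : ℂ)), Complex.ofReal_add, Complex.ofReal_zero,
        Complex.ofReal_mul (3 : ℝ), Complex.ofReal_ofNat] at this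
      exact this
    rw [← mul_assoc, h3, add_mul, add_mul, restrictNeg, if_pos (show y < 0 by omega)]
    congr 1
    split_ifs with hy1
    · subst hy1
      congr 2
      push_cast
      ring
    · simp
  · rw [Finset.Icc_eq_empty (by omega), hgsupp y (by omega), restrictNeg, if_neg (by omega),
      if_neg (by omega)]
    simp

/-- The equation satisfied by the characteristic function of `f`. -/
lemma charSum_bilinear {f g : ℤ → ℝ} {c : ℝ} (hf : Summable f) (hg : Summable g)
    (h : ∀ x : ℤ, c * f x = (∑' j : ℕ, f ((j : ℤ) + x + 1) * f (-(j : ℤ))) + g (-x - 1))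
    (t : ℝ) :
    c * charSum f t = Complex.exp (-(Complex.I * t)) *
      (charSum f t * (f 0 + charSum (restrictNeg f) t) + (starRingEnd ℂ) (charSum g t)) := by
  let v : ℤ → ℝ := fun x => (if x = 0 then f 0 else 0) + restrictNeg f x
  have hvsum := (hasSum_ite_eq (0 : ℤ) (f 0)).summable.add (summable_restrictNeg hf)
  have hv : charSum v t = f 0 + charSum (restrictNeg f) t := by
    refine (hasSum_charSum hvsum t).unique (((hasSum_ite_eq (0 : ℤ) (f 0 : ℂ)).add
      (hasSum_charSum (summable_restrictNeg hf) t)).congr_fun fun x => ?_)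
    rw [Complex.ofReal_add, add_mul]
    congr 1
    split_ifs with hx
    · simp [hx]
    · simp
  have hconv : ∀ y : ℤ, HasSum (fun j => f (y + j) * v (-j))
      (∑' j : ℕ, f ((j : ℤ) + y) * f (-(j : ℤ))) := fun y => by
    have hs : Summable fun j : ℤ => f (y + j) * v (-j) := by
      refine Summable.of_norm_bounded
        (((Equiv.neg ℤ).summable_iff.mpr hvsum.abs).mul_left (∑' x, |f x|)) fun j => ?_
      rw [norm_mul, Real.norm_eq_abs, Real.norm_eq_abs]
      exact mul_le_mul_of_nonneg_right (hf.abs.le_tsum _ fun _ _ => abs_nonneg _) (abs_nonneg _)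
    have hinj : Function.Injective ((↑) : ℕ → ℤ) := Nat.cast_injective
    have hv0 : ∀ j ∉ Set.range ((↑) : ℕ → ℤ), f (y + j) * v (-j) = 0 := fun j hj => by
      have hj0 : j < 0 := by
        by_contra hneg
        exact hj ⟨j.toNat, by omega⟩
      simp only [v, restrictNeg]
      rw [if_neg (by omega), if_neg (by omega), add_zero, mul_zero]
    rw [← hinj.hasSum_iff hv0]
    convert (hinj.summable_iff hv0).mpr hs |>.hasSum using 1
    refine tsum_congr fun j => ?_
    simp only [Function.comp_apply, v, restrictNeg]
    rw [add_comm y]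
    congr 1
    rcases Nat.eq_zero_or_pos j with rfl | hj
    · simp
    · rw [if_neg (by omega), if_pos (by omega), zero_add]
  have h1 := hasSum_charSum_convolution hf hvsum hconv t
  have hgneg : Summable fun x => g (-x) := (Equiv.neg ℤ).summable_iff.mpr hg
  have h2 := h1.add (hasSum_charSum hgneg t)
  rw [← hv, star_charSum]
  have h3 := (Equiv.addRight (1 : ℤ)).hasSum_iff.mpr h2
  refine ((hasSum_charSum hf t).mul_left (c : ℂ)).unique
    ((h3.mul_left (Complex.exp (-(Complex.I * t)))).congr_fun fun x => ?_)
  simp only [Function.comp_apply, Equiv.coe_addRight]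
  have hexp : Complex.exp (Complex.I * (t : ℂ) * (x : ℂ)) = Complex.exp (-(Complex.I * t)) *
      Complex.exp (Complex.I * (t : ℂ) * ((x + 1 : ℤ) : ℂ)) := by
    rw [← Complex.exp_add]
    congr 1
    push_cast
    ring
  rw [← add_mul, ← mul_assoc, ← Complex.ofReal_mul, h x, hexp, ← Complex.ofReal_add, neg_add']
  simp only [add_assoc]
  ring

/-- The two equations combine into a quadratic equation for the characteristic function of `f`
with coefficients depending only on that of `g`. -/
lemma quadratic_of_conj_equations {F G P E : ℂ} {a c : ℝ} (hE : E * (starRingEnd ℂ) E = 1)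
    (hG : 3 * G = P + G ^ 2 + c * E)
    (hF : c * F = E * (F * (a + P) + (starRingEnd ℂ) G))
    (hFP : F = a + P + (starRingEnd ℂ) P) :
    F ^ 2 - F * (3 * G - G ^ 2) + G = 0 := by
  have hFreal : (starRingEnd ℂ) F = F := by
    rw [hFP]
    simp only [map_add, Complex.conj_ofReal, Complex.conj_conj]
    ring
  have h := congrArg (starRingEnd ℂ) hF
  simp only [map_mul, map_add, Complex.conj_ofReal, Complex.conj_conj, hFreal] at h
  linear_combination (-F) * hG + (-E) * h - (F * (a + (starRingEnd ℂ) P) + G) * hE + F * hFP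

/-- The real solutions of the quadratic system relating `F` and `G = 1 + a + b i`. -/
lemma solve_quadratic_system {F a b s : ℝ} (hF : 1 / 2 < F) (hs : 0 < s)
    (hre : (F - 1) ^ 2 - (F - 1) * a + F * (a ^ 2 - b ^ 2) = 0)
    (him : -(F - 1) * b + 2 * F * a * b = 0)
    (hsum : F - 1 = 2 * a - 2 * (a ^ 2 - b ^ 2) + s) :
    (1 - F) ^ 3 = F ^ 2 * s ∧ b ≠ 0 ∧ 2 * F * a = F - 1 ∧
      (2 * F * b) ^ 2 = (F - 1) ^ 2 * (4 * F - 1) := by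
  have hb : b ≠ 0 := by
    rintro rfl
    have ha : a = 0 := by
      have : (4 * F - 1) * a ^ 2 ≤ 0 := by nlinarith [sq_nonneg (2 * (F - 1) - a)]
      have : a ^ 2 ≤ 0 := by nlinarith [sq_nonneg a]
      exact pow_eq_zero_iff two_ne_zero |>.mp (le_antisymm this (sq_nonneg a))
    subst ha
    have h1 : F - 1 = 0 := by
      have : (F - 1) ^ 2 = 0 := by linarith
      exact pow_eq_zero_iff two_ne_zero |>.mp this
    rw [h1] at hsum
    linarith
  have ha : 2 * F * a = F - 1 := mul_right_cancel₀ hb (by linarith)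
  refine ⟨?_, hb, ha, ?_⟩
  · linear_combination (-2 * F) * hre + F ^ 2 * hsum + ha
  · linear_combination (-4 * F) * hre + (2 * F * a - (F - 1)) * ha

/-- If `g` is nonnegative and carried by the negative integers, the imaginary part of its
characteristic function has nonpositive integrals over `[0, s]`. -/
lemma integral_im_charSum_nonpos {g : ℤ → ℝ} (hg : Summable g) (hg0 : ∀ y, 0 ≤ g y)
    (hgsupp : ∀ y : ℤ, 0 ≤ y → g y = 0) (s : ℝ) :
    ∫ t in (0 : ℝ)..s, (charSum g t).im ≤ 0 := by
  have h : HasSum (fun x : ℤ => ∫ t in (0 : ℝ)..s, g x * Real.sin (t * x))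
      (∫ t in (0 : ℝ)..s, (charSum g t).im) := by
    refine intervalIntegral.hasSum_integral_of_dominated_convergence (fun x _ => g x)
      (fun x => (by fun_prop : Continuous _).aestronglyMeasurable) (fun x => ?_)
      (.of_forall fun _ _ => hg) intervalIntegrable_const (.of_forall fun t _ => ?_)
    · refine .of_forall fun t _ => ?_
      rw [norm_mul, Real.norm_eq_abs, abs_of_nonneg (hg0 x)]
      exact mul_le_of_le_one_right (hg0 x) (Real.abs_sin_le_one _)
    · refine (Complex.hasSum_im (hasSum_charSum hg t)).congr_fun fun x => ?_
      have hx : Complex.I * (t : ℂ) * (x : ℂ) = ((t * x : ℝ) : ℂ) * Complex.I := by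
        push_cast
        ring
      rw [hx, Complex.im_ofReal_mul, Complex.exp_ofReal_mul_I_im]
  refine h.nonpos fun x => ?_
  rcases le_or_gt 0 x with hx | hx
  · simp [hgsupp x hx]
  · have hx' : (x : ℝ) < 0 := by exact_mod_cast hx
    rw [intervalIntegral.integral_const_mul, intervalIntegral.integral_comp_mul_right _ hx'.ne,
      integral_sin, zero_mul, Real.cos_zero, smul_eq_mul]
    refine mul_nonpos_of_nonneg_of_nonpos (hg0 x) ?_
    exact mul_nonpos_of_nonpos_of_nonneg (inv_nonpos.mpr hx'.le)
      (sub_nonneg.mpr (Real.cos_le_one _))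

lemma im_charSum_neg {g : ℤ → ℝ} (hg : Summable g) (hg0 : ∀ y, 0 ≤ g y)
    (hgsupp : ∀ y : ℤ, 0 ≤ y → g y = 0) {δ : ℝ}
    (hne : ∀ t ∈ Set.Ioo 0 δ, (charSum g t).im ≠ 0) {t : ℝ} (ht : t ∈ Set.Ioo 0 δ) :
    (charSum g t).im < 0 := by
  have hcont : Continuous fun t => (charSum g t).im :=
    Complex.continuous_im.comp (continuous_charSum hg)
  by_contra! hpos
  have hall : ∀ s ∈ Set.Ioo 0 t, 0 < (charSum g s).im := by
    intro s hs
    by_contra! hneg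
    obtain ⟨r, hr, hr0⟩ := intermediate_value_Icc hs.2.le hcont.continuousOn ⟨hneg, hpos⟩
    exact hne r ⟨hs.1.trans_le hr.1, hr.2.trans_lt ht.2⟩ hr0
  exact (intervalIntegral.intervalIntegral_pos_of_pos_on (hcont.intervalIntegrable _ _) hall
    ht.1).not_ge (integral_im_charSum_nonpos hg hg0 hgsupp t)

lemma isLittleO_sub_mul_of_tendsto_div {u : ℝ → ℂ} {T : ℝ → ℝ} {l : Filter ℝ} {L : ℂ}
    (hT : ∀ᶠ t in l, T t ≠ 0) (h : Tendsto (fun t => u t / (T t : ℂ)) l (𝓝 L)) :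
    (fun t => u t - L * (T t : ℂ)) =o[l] T := by
  have h1 : (fun t => u t - L * (T t : ℂ)) =o[l] fun t => (T t : ℂ) := by
    rw [isLittleO_iff_tendsto' (hT.mono fun t ht h0 => absurd (by exact_mod_cast h0) ht)]
    have h2 := h.sub_const L
    rw [sub_self] at h2
    refine h2.congr' (hT.mono fun t ht => ?_)
    have : (T t : ℂ) ≠ 0 := by exact_mod_cast ht
    field_simp
  exact h1.trans_isBigO (.of_bound 1 (.of_forall fun t => by simp))

lemma one_sub_cos_eq_sinc {t : ℝ} (ht : t ≠ 0) :
    2 * (1 - Real.cos t) = t ^ 2 * Real.sinc (t / 2) ^ 2 := by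
  rw [Real.sinc_of_ne_zero (by positivity), div_pow]
  have h := Real.cos_two_mul (t / 2)
  rw [mul_div_cancel₀ t two_ne_zero] at h
  rw [h, Real.cos_sq']
  field_simp
  ring

lemma tendsto_one_sub_exp_div_rpow :
    Tendsto (fun t : ℝ => (1 - Complex.exp (-(Complex.I * t))) / ((t ^ ((2 : ℝ) / 3) : ℝ) : ℂ))
      (𝓝[>] 0) (𝓝 0) := by
  have hlim : Tendsto (fun t : ℝ => t ^ ((1 : ℝ) / 3)) (𝓝[>] 0) (𝓝 0) := by
    have := (Real.continuousAt_rpow_const (0 : ℝ) ((1 : ℝ) / 3) (Or.inr (by norm_num))).tendsto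
    rw [Real.zero_rpow (by norm_num)] at this
    exact this.mono_left nhdsWithin_le_nhds
  refine squeeze_zero_norm' ?_ hlim
  filter_upwards [self_mem_nhdsWithin] with t ht
  have ht : 0 < t := ht
  have hT : 0 < t ^ ((2 : ℝ) / 3) := Real.rpow_pos_of_pos ht _
  have h := Real.norm_exp_I_mul_ofReal_sub_one_le (x := -t)
  rw [norm_div, Complex.norm_real, Real.norm_of_nonneg hT.le, div_le_iff₀ hT,
    ← Real.rpow_add ht]
  norm_num at h ⊢
  rw [abs_of_pos ht] at h
  rwa [norm_sub_rev]

/-- The local behaviour at `0` of the characteristic functions, in exact form: `F` is real and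
solves a cubic equation, and `G - 1` is an explicit multiple of `F - 1`. -/
lemma charSum_local_form {f g : ℤ → ℝ} {c : ℝ} (hg0 : ∀ y, 0 ≤ g y)
    (hfsum : HasSum f 1) (hgsum : HasSum g 1) (hgsupp : ∀ y : ℤ, 0 ≤ y → g y = 0)
    (hc : 0 < c) (hcf : 2 * c = 3 + f 0)
    (hG : ∀ t : ℝ, 3 * charSum g t = charSum (restrictNeg f) t + charSum g t ^ 2 +
      c * Complex.exp (-(Complex.I * t)))
    (hF : ∀ t : ℝ, c * charSum f t = Complex.exp (-(Complex.I * t)) *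
      (charSum f t * (f 0 + charSum (restrictNeg f) t) + (starRingEnd ℂ) (charSum g t)))
    (hFP : ∀ t : ℝ, charSum f t =
      f 0 + charSum (restrictNeg f) t + (starRingEnd ℂ) (charSum (restrictNeg f) t)) :
    ∀ᶠ t in 𝓝[>] (0 : ℝ), ∃ r : ℝ, charSum f t = r ∧ 1 / 2 < r ∧ r ≤ 1 ∧
      (1 - r) ^ 3 = r ^ 2 * (t ^ 2 * (c * Real.sinc (t / 2) ^ 2)) ∧
      charSum g t - 1 = (r - 1) * ((1 + Complex.I * Real.sqrt (4 * r - 1)) / (2 * r)) := by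
  have hreal : ∀ t, charSum f t = ((charSum f t).re : ℂ) := fun t => by
    apply Complex.ext
    · simp
    · rw [hFP t]
      simp
  have hcont : Continuous fun t => (charSum f t).re :=
    Complex.continuous_re.comp (continuous_charSum hfsum.summable)
  have hev : ∀ᶠ t in 𝓝 (0 : ℝ), 1 / 2 < (charSum f t).re := by
    refine hcont.continuousAt.eventually (lt_mem_nhds ?_)
    simp only [charSum_zero hfsum, Complex.ofReal_re]
    norm_num
  obtain ⟨δ₀, hδ₀, hball⟩ := Metric.eventually_nhds_iff.mp hev
  have hsys : ∀ t ∈ Set.Ioo 0 (min δ₀ 1),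
      1 / 2 < (charSum f t).re ∧
      (1 - (charSum f t).re) ^ 3 = (charSum f t).re ^ 2 * (2 * c * (1 - Real.cos t)) ∧
      (charSum g t).im ≠ 0 ∧
      2 * (charSum f t).re * ((charSum g t).re - 1) = (charSum f t).re - 1 ∧
      (2 * (charSum f t).re * (charSum g t).im) ^ 2 =
        ((charSum f t).re - 1) ^ 2 * (4 * (charSum f t).re - 1) := by
    intro t ht
    have ht0 : 0 < t := ht.1
    have ht1 : t < 1 := ht.2.trans_le (min_le_right _ _)
    have hr : 1 / 2 < (charSum f t).re := by
      refine hball ?_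
      rw [Real.dist_eq, sub_zero, abs_of_pos ht0]
      exact ht.2.trans_le (min_le_left _ _)
    have hexp : Complex.exp (-(Complex.I * t)) = Real.cos t - Complex.I * Real.sin t := by
      rw [show -(Complex.I * (t : ℂ)) = ((-t : ℝ) : ℂ) * Complex.I by push_cast; ring,
        Complex.exp_mul_I, ← Complex.ofReal_cos, ← Complex.ofReal_sin, Real.cos_neg, Real.sin_neg]
      push_cast
      ring
    have hE : Complex.exp (-(Complex.I * t)) *
        (starRingEnd ℂ) (Complex.exp (-(Complex.I * t))) = 1 := by
      rw [← Complex.exp_conj, ← Complex.exp_add]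
      simp
    have hquad := quadratic_of_conj_equations hE (hG t) (hF t) (hFP t)
    rw [hreal t] at hquad
    have hre := congrArg Complex.re hquad
    have him := congrArg Complex.im hquad
    have hsum := congrArg Complex.re (hFP t)
    have hGre := congrArg Complex.re (hG t)
    rw [hexp] at hGre
    simp [sq, -Complex.ofReal_cos, -Complex.ofReal_sin] at hre him hsum hGre
    have hcos : Real.cos t < 1 := by
      rw [← Real.cos_zero]
      exact Real.cos_lt_cos_of_nonneg_of_le_pi_div_two le_rfl
        (by linarith [Real.pi_gt_three]) ht0
    refine ⟨hr, solve_quadratic_system hr (by nlinarith) ?_ ?_ ?_⟩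
    · linear_combination hre
    · linear_combination him
    · linear_combination hsum - 2 * hGre - hcf
  have hδ : 0 < min δ₀ 1 := lt_min hδ₀ one_pos
  filter_upwards [Ioo_mem_nhdsGT hδ] with t ht
  obtain ⟨hr, hcube, -, ha, hb⟩ := hsys t ht
  have hcos := one_sub_cos_eq_sinc ht.1.ne'
  have hcube' : (1 - (charSum f t).re) ^ 3 =
      (charSum f t).re ^ 2 * (t ^ 2 * (c * Real.sinc (t / 2) ^ 2)) := by
    rw [hcube]
    linear_combination (charSum f t).re ^ 2 * c * hcos
  have hle : (charSum f t).re ≤ 1 := by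
    have : 0 ≤ (1 - (charSum f t).re) ^ 3 := by
      rw [hcube']
      positivity
    linarith [(Odd.pow_nonneg_iff (n := 3) (by decide)).mp this]
  refine ⟨_, hreal t, hr, hle, hcube', ?_⟩
  have him := im_charSum_neg hgsum.summable hg0 hgsupp (fun s hs => (hsys s hs).2.2.1) ht
  set r := (charSum f t).re
  have hsqrt : 0 ≤ 4 * r - 1 := by linarith
  have hb' : 2 * r * (charSum g t).im = (r - 1) * Real.sqrt (4 * r - 1) := by
    have h1 : (-(2 * r * (charSum g t).im)) ^ 2 = ((1 - r) * Real.sqrt (4 * r - 1)) ^ 2 := by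
      rw [neg_sq, hb, mul_pow, Real.sq_sqrt hsqrt]
      ring
    have h2 := (pow_left_inj₀ (by nlinarith)
      (mul_nonneg (sub_nonneg.mpr hle) (Real.sqrt_nonneg _)) two_ne_zero).mp h1
    linarith
  have hr0 : (r : ℂ) ≠ 0 := by
    exact_mod_cast (by linarith : (0 : ℝ) < r).ne'
  rw [← Complex.re_add_im (charSum g t)]
  have haC : 2 * (r : ℂ) * ((charSum g t).re - 1) = r - 1 := by exact_mod_cast ha
  have hbC : 2 * (r : ℂ) * (charSum g t).im = (r - 1) * (Real.sqrt (4 * r - 1) : ℂ) := by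
    exact_mod_cast hb'
  field_simp
  linear_combination haC + Complex.I * hbC

/-- Suppose `(f, g)` satisfies the LDP recursive equation, and set `κ = 3 + f 0 > 0`.
Then as `t ↓ 0`:
`F(t) = 1 - (κ/2)^{1/3} t^{2/3} + o(t^{2/3})`,
`F⁻(t) = (1 - f 0)/2 + ((-1 - i√3)/2) (κ/2)^{1/3} t^{2/3} + o(t^{2/3})`, and
`G(t) = 1 + ((-1 - i√3)/2) (κ/2)^{1/3} t^{2/3} + o(t^{2/3})`. -/
theorem stmt_9
    (f g : ℤ → ℝ)
    (hf0 : ∀ x, 0 ≤ f x) (hg0 : ∀ y, 0 ≤ g y)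
    (hfsum : HasSum f 1) (hgsum : HasSum g 1)
    (hfsymm : ∀ x, f (-x) = f x)
    (hgsupp : ∀ y : ℤ, 0 ≤ y → g y = 0)
    (hrec : ∀ x y : ℤ, y ≤ -1 →
      3 * f x * g y =
        f x * f y + f x * (∑ j ∈ Finset.Icc (1 : ℤ) (-y - 1), g (y + j) * g (-j)) +
          (if y = -1 then (∑' j : ℕ, f ((j : ℤ) + x + 1) * f (-(j : ℤ))) + g (-x - 1)
            else 0))
    (F Fminus G : ℝ → ℂ)
    (hF : ∀ t : ℝ, F t = ∑' x : ℤ, (f x : ℂ) * Complex.exp (Complex.I * (t : ℂ) * (x : ℂ)))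
    (hFminus : ∀ t : ℝ, Fminus t =
      ∑' k : ℕ, (f (-(k : ℤ) - 1) : ℂ) * Complex.exp (Complex.I * (t : ℂ) * (-(k : ℂ) - 1)))
    (hG : ∀ t : ℝ, G t =
      ∑' k : ℕ, (g (-(k : ℤ) - 1) : ℂ) * Complex.exp (Complex.I * (t : ℂ) * (-(k : ℂ) - 1)))
    (κ : ℝ) (hκ : κ = 3 + f 0) :
    0 < κ ∧
    ((fun t : ℝ => F t - ((1 - (κ / 2) ^ ((1 : ℝ) / 3) * t ^ ((2 : ℝ) / 3) : ℝ) : ℂ))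
        =o[𝓝[>] (0 : ℝ)] fun t : ℝ => t ^ ((2 : ℝ) / 3)) ∧
    ((fun t : ℝ => Fminus t -
        ((((1 - f 0) / 2 : ℝ) : ℂ) +
          ((-1 : ℂ) - Complex.I * (Real.sqrt 3 : ℂ)) / 2 *
            (((κ / 2) ^ ((1 : ℝ) / 3) * t ^ ((2 : ℝ) / 3) : ℝ) : ℂ)))
        =o[𝓝[>] (0 : ℝ)] fun t : ℝ => t ^ ((2 : ℝ) / 3)) ∧
    ((fun t : ℝ => G t -
        (1 + ((-1 : ℂ) - Complex.I * (Real.sqrt 3 : ℂ)) / 2 *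
            (((κ / 2) ^ ((1 : ℝ) / 3) * t ^ ((2 : ℝ) / 3) : ℝ) : ℂ)))
        =o[𝓝[>] (0 : ℝ)] fun t : ℝ => t ^ ((2 : ℝ) / 3)) := by
  have hF' : F = charSum f := funext fun t => hF t
  have hG' : G = charSum g := funext fun t => by rw [hG t, charSum_eq_tsum_nat hgsupp]
  have hP' : Fminus = charSum (restrictNeg f) := funext fun t => by
    rw [hFminus t, charSum_eq_tsum_nat (u := restrictNeg f) fun x hx => if_neg hx.not_gt]
    refine tsum_congr fun k => ?_
    rw [restrictNeg, if_pos (by omega)]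
  have hκ0 : 0 < κ := by linarith [hf0 0]
  refine ⟨hκ0, ?_⟩
  obtain ⟨c, hc⟩ : ∃ c, c = 3 * g (-1) - f (-1) := ⟨_, rfl⟩
  have hfx : ∀ x : ℤ, c * f x =
      (∑' j : ℕ, f ((j : ℤ) + x + 1) * f (-(j : ℤ))) + g (-x - 1) := fun x => by
    have h := hrec x (-1) le_rfl
    rw [if_pos rfl, Finset.Icc_eq_empty (by norm_num), Finset.sum_empty] at h
    rw [hc]
    linarith
  obtain ⟨x₀, hx₀⟩ : ∃ x, f x ≠ 0 := by
    by_contra! h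
    exact one_ne_zero (hfsum.unique ((hasSum_zero (α := ℝ)).congr_fun h))
  have hgy : ∀ y : ℤ, y ≤ -1 → 3 * g y =
      f y + (∑ j ∈ Finset.Icc (1 : ℤ) (-y - 1), g (y + j) * g (-j)) +
        if y = -1 then c else 0 := fun y hy => by
    split_ifs with h1
    · rw [h1, Finset.Icc_eq_empty (by norm_num), Finset.sum_empty, hc]
      ring
    · have h := hrec x₀ y hy
      rw [if_neg h1] at h
      refine mul_left_cancel₀ hx₀ ?_
      linarith
  have hGeq := charSum_quadratic hfsum.summable hgsum.summable hgsupp hgy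
  have hFeq := charSum_bilinear hfsum.summable hgsum.summable hfx
  have hFP := charSum_of_symm hfsum.summable hfsymm
  have hcκ : c = κ / 2 := by
    have h1 := hGeq 0
    have h2 := hFeq 0
    rw [charSum_zero hgsum] at h1 h2
    rw [charSum_zero hfsum] at h2
    simp at h1 h2
    have h3 : ((2 * c : ℝ) : ℂ) = ((3 + f 0 : ℝ) : ℂ) := by
      push_cast
      linear_combination h2 - h1
    have h4 : 2 * c = 3 + f 0 := by exact_mod_cast h3
    linarith
  have hform := charSum_local_form hg0 hfsum hgsum hgsupp (by linarith : 0 < c) (by linarith)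
    hGeq hFeq hFP
  have hT : ∀ᶠ t : ℝ in 𝓝[>] 0, t ^ ((2 : ℝ) / 3) ≠ 0 := by
    filter_upwards [self_mem_nhdsWithin] with t ht
    exact (Real.rpow_pos_of_pos ht _).ne'
  have hre : Tendsto (fun t => (charSum f t).re) (𝓝[>] 0) (𝓝 1) := by
    have h := (Complex.continuous_re.comp (continuous_charSum hfsum.summable)).tendsto 0
    simp only [Function.comp_apply, charSum_zero hfsum, Complex.ofReal_re] at h
    exact h.mono_left nhdsWithin_le_nhds
  have hlim : Tendsto (fun t => (1 - (charSum f t).re) / t ^ ((2 : ℝ) / 3)) (𝓝[>] 0)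
      (𝓝 ((κ / 2) ^ ((1 : ℝ) / 3))) := by
    have hsinc : Tendsto (fun t : ℝ => Real.sinc (t / 2)) (𝓝[>] 0) (𝓝 1) := by
      have h := (Real.continuous_sinc.comp (continuous_id.div_const (2 : ℝ))).tendsto 0
      simp only [Function.comp_apply, id_eq, zero_div, Real.sinc_zero] at h
      exact h.mono_left nhdsWithin_le_nhds
    have h := ((hre.pow 2).mul ((hsinc.pow 2).const_mul c)).rpow_const (p := (1 : ℝ) / 3)
      (Or.inr (by norm_num))
    rw [one_pow, one_mul, mul_one, hcκ] at h
    refine h.congr' ?_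
    filter_upwards [hform, self_mem_nhdsWithin] with t ⟨r, hr, hr0, hr1, hcube, _⟩ ht
    have ht : 0 < t := ht
    rw [hr, Complex.ofReal_re, ← hcκ]
    have hTpos := Real.rpow_pos_of_pos ht ((2 : ℝ) / 3)
    have hT3 : (t ^ ((2 : ℝ) / 3)) ^ 3 = t ^ 2 := by
      rw [← Real.rpow_natCast, ← Real.rpow_mul ht.le, ← Real.rpow_natCast]
      norm_num
    have hq : 0 ≤ (1 - r) / t ^ ((2 : ℝ) / 3) := div_nonneg (by linarith) hTpos.le
    have h3 : r ^ 2 * (c * Real.sinc (t / 2) ^ 2) = ((1 - r) / t ^ ((2 : ℝ) / 3)) ^ 3 := by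
      rw [div_pow, hT3, hcube]
      field_simp
    rw [h3, one_div]
    exact Real.pow_rpow_inv_natCast (n := 3) hq (by norm_num)
  have hlimF : Tendsto (fun t => (charSum f t - 1) / ((t ^ ((2 : ℝ) / 3) : ℝ) : ℂ)) (𝓝[>] 0)
      (𝓝 (-(((κ / 2) ^ ((1 : ℝ) / 3) : ℝ) : ℂ))) := by
    refine ((Complex.continuous_ofReal.tendsto _).comp hlim).neg.congr' ?_
    filter_upwards [hform] with t ⟨r, hr, _⟩
    simp only [Function.comp_apply, hr, Complex.ofReal_re]
    push_cast
    ring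
  have hw : Tendsto (fun t => (1 + Complex.I * Real.sqrt (4 * (charSum f t).re - 1)) /
      (2 * ((charSum f t).re : ℂ))) (𝓝[>] 0) (𝓝 ((1 + Complex.I * Real.sqrt 3) / 2)) := by
    have h1 := (Complex.continuous_ofReal.tendsto _).comp
      ((Real.continuous_sqrt.tendsto _).comp ((hre.const_mul 4).sub_const 1))
    have h2 := (Complex.continuous_ofReal.tendsto _).comp hre
    have h3 := ((h1.const_mul Complex.I).const_add 1).div (h2.const_mul 2) (by simp)
    norm_num at h3
    exact h3
  have hlimG : Tendsto (fun t => (charSum g t - 1) / ((t ^ ((2 : ℝ) / 3) : ℝ) : ℂ)) (𝓝[>] 0)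
      (𝓝 (((-1 : ℂ) - Complex.I * (Real.sqrt 3 : ℂ)) / 2 *
        (((κ / 2) ^ ((1 : ℝ) / 3) : ℝ) : ℂ))) := by
    have h := hlimF.mul hw
    rw [show -(((κ / 2) ^ ((1 : ℝ) / 3) : ℝ) : ℂ) * ((1 + Complex.I * Real.sqrt 3) / 2) =
      ((-1 : ℂ) - Complex.I * (Real.sqrt 3 : ℂ)) / 2 * (((κ / 2) ^ ((1 : ℝ) / 3) : ℝ) : ℂ) by
        ring] at h
    refine h.congr' ?_
    filter_upwards [hform] with t ⟨r, hr, _, _, _, hg⟩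
    rw [hg, hr, Complex.ofReal_re]
    ring
  have hlimP : Tendsto (fun t => (charSum (restrictNeg f) t - (((1 - f 0) / 2 : ℝ) : ℂ)) /
      ((t ^ ((2 : ℝ) / 3) : ℝ) : ℂ)) (𝓝[>] 0)
      (𝓝 (((-1 : ℂ) - Complex.I * (Real.sqrt 3 : ℂ)) / 2 *
        (((κ / 2) ^ ((1 : ℝ) / 3) : ℝ) : ℂ))) := by
    have hg1 : Tendsto (charSum g) (𝓝[>] 0) (𝓝 1) := by
      have h := (continuous_charSum hgsum.summable).tendsto 0
      rw [charSum_zero hgsum, Complex.ofReal_one] at h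
      exact h.mono_left nhdsWithin_le_nhds
    have h := (hlimG.mul (hg1.const_sub 2)).add (tendsto_one_sub_exp_div_rpow.const_mul (c : ℂ))
    rw [show (2 : ℂ) - 1 = 1 by norm_num, mul_one, mul_zero, add_zero] at h
    refine h.congr fun t => ?_
    have hf0c : (((1 - f 0) / 2 : ℝ) : ℂ) = 2 - c := by
      have : (1 - f 0) / 2 = 2 - c := by linarith
      rw [this]
      push_cast
      ring
    rw [div_mul_eq_mul_div, mul_div_assoc', ← add_div, hf0c]
    congr 1
    linear_combination hGeq t
  rw [hF', hG', hP']
  refine ⟨?_, ?_, ?_⟩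
  · refine (isLittleO_sub_mul_of_tendsto_div hT hlimF).congr_left fun t => ?_
    push_cast
    ring
  · refine (isLittleO_sub_mul_of_tendsto_div hT hlimP).congr_left fun t => ?_
    push_cast
    ring
  · refine (isLittleO_sub_mul_of_tendsto_div hT hlimG).congr_left fun t => ?_
    push_cast
    ring
end
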